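/- Let k be a field and A a finite-dimensional k-algebra. Let e_1, …, e_ℓ be pairwise orthogonal idempotents of A with e_1 + ⋯ + e_ℓ = 1, such that for every i the subalgebra e_i A e_i is a division ring, and such that e_j A e_i = 0 whenever i > j. Then the right A-modules e_1 A, …, e_ℓ A are indecomposable and pairwise non-isomorphic; in particular, A is a basic k-algebra. -/

import Mathlib

/-- A module is *indecomposable* if it is nontrivial and does not split as the direct sum
of two nonzero submodules. -/
def IsIndecomposableModule (R M : Type) [Ring R] [AddCommGroup M] [Module R M] : Prop :=
  Nontrivial M ∧ ∀ N₁ N₂ : Submodule R M, IsCompl N₁ N₂ → N₁ = ⊥ ∨ N₂ = ⊥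

/-- An algebra `B` is *basic* if in some decomposition of `B`, as a right
module over itself, into a finite direct sum of indecomposable right `B`-modules, the
indecomposable summands are pairwise non-isomorphic. -/
def IsBasicAlgebra (B : Type) [Ring B] : Prop :=
  ∃ (n : ℕ) (P : Fin n → Submodule Bᵐᵒᵖ B),
    DirectSum.IsInternal P ∧ (∀ i, IsIndecomposableModule Bᵐᵒᵖ (P i)) ∧
      ∀ i j, i ≠ j → IsEmpty ((P i) ≃ₗ[Bᵐᵒᵖ] (P j))

/-- For `u : A`, the subset `uA = {u * a | a ∈ A}` is a right ideal of `A`, i.e. a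
submodule of `A` regarded as a right module over itself. -/
def leftMulRange {A : Type} [Ring A] (u : A) : Submodule Aᵐᵒᵖ A where
  carrier := Set.range (fun a => u * a)
  add_mem' := by
    rintro x y ⟨a, rfl⟩ ⟨b, rfl⟩
    exact ⟨a + b, by simp [mul_add]⟩
  zero_mem' := ⟨0, by simp⟩
  smul_mem' := by
    rintro c x ⟨a, rfl⟩
    exact ⟨a * c.unop, by simp [MulOpposite.smul_eq_mul_unop, mul_assoc]⟩

section LeftMulRange

open MulOpposite

variable {A : Type} [Ring A]

lemma self_mem_leftMulRange (u : A) : u ∈ leftMulRange u := ⟨1, mul_one u⟩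

lemma IsIdempotentElem.mul_eq_of_mem_leftMulRange {u x : A} (hu : IsIdempotentElem u)
    (hx : x ∈ leftMulRange u) : u * x = x := by
  obtain ⟨a, rfl⟩ := hx
  rw [← mul_assoc, hu.eq]

lemma IsIdempotentElem.submodule_eq_top_of_mem {u : A} (hu : IsIdempotentElem u)
    {N : Submodule Aᵐᵒᵖ (leftMulRange u)} (hN : ⟨u, self_mem_leftMulRange u⟩ ∈ N) : N = ⊤ := by
  rw [eq_top_iff]
  rintro ⟨x, hx⟩ -
  convert N.smul_mem (op x) hN using 1
  exact Subtype.ext (hu.mul_eq_of_mem_leftMulRange hx).symm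

/-- If every nonzero element of `uAu` is right invertible in `uAu`, then `uA` is
indecomposable. -/
lemma IsIdempotentElem.isIndecomposableModule_leftMulRange {u : A} (hu : IsIdempotentElem u)
    (hne : u ≠ 0) (hinv : ∀ a, u * a * u ≠ 0 → ∃ b, u * a * u * b = u) :
    IsIndecomposableModule Aᵐᵒᵖ (leftMulRange u) := by
  refine ⟨⟨⟨⟨u, self_mem_leftMulRange u⟩, 0, fun h ↦ hne (Subtype.ext_iff.1 h)⟩⟩, fun N₁ N₂ hN ↦ ?_⟩
  obtain ⟨x, hx, y, hy, hxy⟩ := Submodule.mem_sup.1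
    (hN.sup_eq_top ▸ Submodule.mem_top : ⟨u, self_mem_leftMulRange u⟩ ∈ N₁ ⊔ N₂)
  have hxy' : (x : A) + y = u := Subtype.ext_iff.1 hxy
  have hux := hu.mul_eq_of_mem_leftMulRange x.2
  by_cases h : u * (x : A) * u = 0
  · left
    suffices N₂ = ⊤ from disjoint_top.1 (this ▸ hN.disjoint)
    apply hu.submodule_eq_top_of_mem
    convert N₂.smul_mem (op u) hy using 1
    refine Subtype.ext (?_ : u = (y : A) * u)
    rw [hux] at h
    rw [← zero_add ((y : A) * u), ← h, ← add_mul, hxy', hu.eq]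
  · right
    obtain ⟨b, hb⟩ := hinv _ h
    suffices N₁ = ⊤ from top_disjoint.1 (this ▸ hN.disjoint)
    apply hu.submodule_eq_top_of_mem
    convert N₁.smul_mem (op (u * b)) hx using 1
    refine Subtype.ext (?_ : u = (x : A) * (u * b))
    rw [← mul_assoc, ← hux, hb]

/-- If `vAu = 0`, then there is no injective homomorphism of right modules `uA → vA`. -/
lemma IsIdempotentElem.not_injective_of_forall_mul_mul_eq_zero {u v : A}
    (hu : IsIdempotentElem u) (hne : u ≠ 0) (h : ∀ a, v * a * u = 0)
    (f : leftMulRange u →ₗ[Aᵐᵒᵖ] leftMulRange v) : ¬ Function.Injective f := by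
  intro hf
  let g : leftMulRange u := ⟨u, self_mem_leftMulRange u⟩
  have hg : op u • g = g := Subtype.ext hu.eq
  have hfg : f g = 0 := by
    rw [← hg, map_smul]
    obtain ⟨a, ha⟩ := (f g).2
    refine Subtype.ext (?_ : (f g : A) * u = 0)
    rw [← ha]
    exact h a
  exact hne (Subtype.ext_iff.1 (hf (hfg.trans (map_zero f).symm)))

lemma CompleteOrthogonalIdempotents.isInternal_leftMulRange {ι : Type*} [Fintype ι]
    [DecidableEq ι] {e : ι → A} (he : CompleteOrthogonalIdempotents e) :
    DirectSum.IsInternal fun i ↦ leftMulRange (e i) := by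
  rw [DirectSum.isInternal_submodule_iff_iSupIndep_and_iSup_eq_top]
  constructor
  · intro i
    rw [Submodule.disjoint_def]
    intro x hx hx'
    have hle : ⨆ j, ⨆ (_ : j ≠ i), leftMulRange (e j) ≤
        LinearMap.ker (DistribSMul.toLinearMap Aᵐᵒᵖ A (e i)) := by
      refine iSup₂_le fun j hj ↦ ?_
      rintro _ ⟨a, rfl⟩
      change e i * (e j * a) = 0
      rw [← mul_assoc, he.ortho hj.symm, zero_mul]
    rw [← (he.idem i).mul_eq_of_mem_leftMulRange hx]
    exact hle hx'
  · rw [eq_top_iff]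
    rintro x -
    rw [← one_mul x, ← he.complete, Finset.sum_mul]
    exact Submodule.sum_mem _ fun i _ ↦
      Submodule.mem_iSup_of_mem (p := fun i ↦ leftMulRange (e i)) i ⟨x, rfl⟩

end LeftMulRange

/-- Let `A` be a finite-dimensional `k`-algebra and `e 1, …, e ℓ` pairwise orthogonal
idempotents summing to `1`, such that each `eᵢ A eᵢ` is a division ring (with unit `eᵢ`),
and such that `eⱼ A eᵢ = 0` whenever `i > j`.  Then the right `A`-modules `eᵢ A` are
indecomposable and pairwise non-isomorphic; in particular `A` is a basic `k`-algebra. -/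
theorem basic_of_weakly_exceptional_idempotents
    {k A : Type} [Field k] [Ring A] [Algebra k A] [FiniteDimensional k A]
    {ℓ : ℕ} (e : Fin ℓ → A)
    (hidem : ∀ i, IsIdempotentElem (e i))
    (horth : ∀ i j, i ≠ j → e i * e j = 0)
    (hsum : ∑ i, e i = 1)
    -- each `eᵢ A eᵢ` is a division ring with unit `eᵢ`:
    (hne : ∀ i, e i ≠ 0)
    (hdiv : ∀ i (a : A), e i * a * e i ≠ 0 →
      ∃ b : A, (e i * a * e i) * (e i * b * e i) = e i ∧
        (e i * b * e i) * (e i * a * e i) = e i)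
    -- semi-orthogonality: `eⱼ A eᵢ = 0` for `i > j`:
    (hvan : ∀ i j : Fin ℓ, j < i → ∀ a : A, e j * a * e i = 0) :
    (∀ i, IsIndecomposableModule Aᵐᵒᵖ (leftMulRange (e i))) ∧
    (∀ i j, i ≠ j → IsEmpty ((leftMulRange (e i)) ≃ₗ[Aᵐᵒᵖ] (leftMulRange (e j)))) ∧
    IsBasicAlgebra A := by
  have hindec i : IsIndecomposableModule Aᵐᵒᵖ (leftMulRange (e i)) :=
    (hidem i).isIndecomposableModule_leftMulRange (hne i) fun a ha ↦
      (hdiv i a ha).imp' (fun b ↦ e i * b * e i) fun _ hb ↦ hb.1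
  have hiso i j (hij : i ≠ j) :
      IsEmpty ((leftMulRange (e i)) ≃ₗ[Aᵐᵒᵖ] (leftMulRange (e j))) := by
    refine ⟨fun f ↦ ?_⟩
    rcases hij.lt_or_gt with h | h
    · exact (hidem j).not_injective_of_forall_mul_mul_eq_zero (hne j) (hvan j i h)
        f.symm.toLinearMap f.symm.injective
    · exact (hidem i).not_injective_of_forall_mul_mul_eq_zero (hne i) (hvan i j h)
        f.toLinearMap f.injective
  have he : CompleteOrthogonalIdempotents e := ⟨⟨hidem, horth⟩, hsum⟩
  exact ⟨hindec, hiso, ℓ, _, he.isInternal_leftMulRange, hindec, hiso⟩
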